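/- Let A be a finite-dimensional Z-graded K-algebra with triangular decomposition (A⁻,T,A⁺). Then A is semisimple if and only if T is semisimple and both Δ̄(λ) and ∇̄(λ) are simple for every simple T-module λ. -/

import Mathlib

open scoped TensorProduct

universe u

namespace TriangularPaper

variable (K A : Type u) [Field K] [Ring A] [Algebra K A]

/-- The multiplication map `M ⊗ N → A` for two `K`-subspaces of `A`. -/
noncomputable def mulMap (M N : Submodule K A) : (↥M ⊗[K] ↥N) →ₗ[K] A :=
  (LinearMap.mul' K A).comp (TensorProduct.map M.subtype N.subtype)

/-- The triple multiplication map `(P ⊗ Q) ⊗ R → A`. -/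
noncomputable def triMulMap (P Q R : Submodule K A) :
    ((↥P ⊗[K] ↥Q) ⊗[K] ↥R) →ₗ[K] A :=
  (LinearMap.mul' K A).comp (TensorProduct.map (mulMap K A P Q) R.subtype)

/-- A triangular decomposition `(A⁻, T, A⁺)` of the finite-dimensional graded algebra `A`
with internal grading `𝒜`, in the sense of Holmes–Nakano. -/
structure TriangularDecomposition (𝒜 : ℤ → Submodule K A)
    (Am T Ap : Subalgebra K A) : Prop where
  /-- `𝒜` is a grading of `A` -/
  internal : DirectSum.IsInternal 𝒜
  one_mem : (1 : A) ∈ 𝒜 0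
  mul_mem : ∀ i j : ℤ, ∀ a b : A, a ∈ 𝒜 i → b ∈ 𝒜 j → a * b ∈ 𝒜 (i + j)
  /-- multiplication `A⁻ ⊗ T ⊗ A⁺ → A` is a linear isomorphism -/
  mul_bij : Function.Bijective (triMulMap K A Am.toSubmodule T.toSubmodule Ap.toSubmodule)
  /-- `T` is concentrated in degree `0` -/
  T_deg0 : T.toSubmodule ≤ 𝒜 0
  /-- `A⁻` is supported in nonpositive degrees -/
  neg_supp : Am.toSubmodule ≤ ⨆ n : ℕ, 𝒜 (-(n : ℤ))
  /-- `A⁺` is supported in nonnegative degrees -/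
  pos_supp : Ap.toSubmodule ≤ ⨆ n : ℕ, 𝒜 (n : ℤ)
  /-- `A⁻` is a graded subalgebra -/
  neg_graded : Am.toSubmodule = ⨆ i : ℤ, Am.toSubmodule ⊓ 𝒜 i
  /-- `A⁺` is a graded subalgebra -/
  pos_graded : Ap.toSubmodule = ⨆ i : ℤ, Ap.toSubmodule ⊓ 𝒜 i
  /-- `A⁻₀ = K` -/
  neg_deg0 : Am.toSubmodule ⊓ 𝒜 0 = Submodule.span K {(1 : A)}
  /-- `A⁺₀ = K` -/
  pos_deg0 : Ap.toSubmodule ⊓ 𝒜 0 = Submodule.span K {(1 : A)}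
  /-- `A⁺T = TA⁺` as subspaces of `A` -/
  comm_pos : Ap.toSubmodule * T.toSubmodule = T.toSubmodule * Ap.toSubmodule
  /-- `A⁻T = TA⁻` as subspaces of `A` -/
  comm_neg : Am.toSubmodule * T.toSubmodule = T.toSubmodule * Am.toSubmodule
  /-- `T` is a split `K`-algebra -/
  T_split : ∀ (V : Type u) [AddCommGroup V] [Module ↥T V], IsSimpleModule ↥T V →
    ∀ f : V →ₗ[↥T] V, ∃ c : K, ∀ v, f v = algebraMap K ↥T c • v

/-- The negative Borel subalgebra `B⁻ = A⁻T` (as a subspace). -/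
noncomputable def Bneg (Am T : Subalgebra K A) : Submodule K A :=
  Am.toSubmodule * T.toSubmodule

/-- The positive Borel subalgebra `B⁺ = A⁺T` (as a subspace). -/
noncomputable def Bpos (T Ap : Subalgebra K A) : Submodule K A :=
  Ap.toSubmodule * T.toSubmodule

/-- The augmentation ideal `J⁺` of the positive Borel subalgebra. -/
noncomputable def Jpos (𝒜 : ℤ → Submodule K A) (T Ap : Subalgebra K A) : Submodule K A :=
  ⨆ (i : ℤ) (_ : 0 < i), Bpos K A T Ap ⊓ 𝒜 i

/-- The augmentation ideal `J⁻` of the negative Borel subalgebra. -/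
noncomputable def Jneg (𝒜 : ℤ → Submodule K A) (Am T : Subalgebra K A) : Submodule K A :=
  ⨆ (i : ℤ) (_ : i < 0), Bneg K A Am T ⊓ 𝒜 i

/-- `(D, ι)` realizes the proper standard module `Δ̄(M) = A ⊗_{B⁺} Inf_T^{B⁺} M`,
expressed through its universal property `Hom_A(Δ̄(M), N) ≅ Hom_{B⁺}(Inf M, Res N)`. -/
def IsProperStandardFor (𝒜 : ℤ → Submodule K A) (T Ap : Subalgebra K A)
    (M : Type u) [AddCommGroup M] [Module ↥T M]
    (D : Type u) [AddCommGroup D] [Module A D] (ι : M →+ D) : Prop :=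
  (∀ (t : ↥T) (m : M), ι (t • m) = (t : A) • ι m) ∧
  (∀ a ∈ Jpos K A 𝒜 T Ap, ∀ m : M, a • ι m = 0) ∧
  ∀ (N : Type u) [AddCommGroup N] [Module A N] (f : M →+ N),
    (∀ (t : ↥T) (m : M), f (t • m) = (t : A) • f m) →
    (∀ a ∈ Jpos K A 𝒜 T Ap, ∀ m : M, a • f m = 0) →
    ∃! F : D →ₗ[A] N, ∀ m, F (ι m) = f m

/-- `(D, p)` realizes the proper costandard module `∇̄(M)`, expressed through its
couniversal property `Hom_A(N, ∇̄(M)) ≅ Hom_{B⁻}(Res N, Inf M)`. -/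
def IsProperCostandardFor (𝒜 : ℤ → Submodule K A) (Am T : Subalgebra K A)
    (M : Type u) [AddCommGroup M] [Module ↥T M]
    (D : Type u) [AddCommGroup D] [Module A D] (p : D →+ M) : Prop :=
  (∀ (t : ↥T) (x : D), p ((t : A) • x) = t • p x) ∧
  (∀ a ∈ Jneg K A 𝒜 Am T, ∀ x : D, p (a • x) = 0) ∧
  ∀ (N : Type u) [AddCommGroup N] [Module A N] (f : N →+ M),
    (∀ (t : ↥T) (x : N), f ((t : A) • x) = t • f x) →
    (∀ a ∈ Jneg K A 𝒜 Am T, ∀ x : N, f (a • x) = 0) →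
    ∃! F : N →ₗ[A] D, ∀ x, p (F x) = f x

/-- A compatible grading on an `A`-module `D`, making it an object of `𝒢(A)`. -/
def IsModuleGrading (𝒜 : ℤ → Submodule K A) {D : Type u} [AddCommGroup D] [Module A D]
    [Module K D] [IsScalarTower K A D] (ℳ : ℤ → Submodule K D) : Prop :=
  DirectSum.IsInternal ℳ ∧
    ∀ (i j : ℤ) (a : A) (x : D), a ∈ 𝒜 i → x ∈ ℳ j → a • x ∈ ℳ (i + j)

end TriangularPaper

namespace TriangularPaper

/-- The additive maps `A → V`, regarded as a left `A`-module through right multiplication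
on the source. -/
def Coind (A V : Type u) [Ring A] [AddCommGroup V] : Type u := A →+ V

section Coinduction

variable {A V : Type u} [Ring A] [AddCommGroup V]

noncomputable instance : AddCommGroup (Coind A V) :=
  inferInstanceAs (AddCommGroup (A →+ V))

/-- Evaluation of a coinduced element. -/
def Coind.eval : Coind A V →+ (A →+ V) := AddMonoidHom.id (A →+ V)

theorem Coind.ext {f g : Coind A V} (h : ∀ a, f.eval a = g.eval a) : f = g :=
  AddMonoidHom.ext h

/-- An additive map, regarded as a coinduced element. -/
def Coind.of (f : A →+ V) : Coind A V := f

@[simp] theorem Coind.eval_of (f : A →+ V) : (Coind.of f).eval = f := rfl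

noncomputable instance : Module A (Coind A V) where
  smul a f := Coind.of (f.eval.comp (AddMonoidHom.mulRight a))
  one_smul f := Coind.ext fun x => congrArg f.eval (mul_one x)
  mul_smul a b f := Coind.ext fun x => congrArg f.eval (mul_assoc x a b).symm
  smul_zero _ := rfl
  smul_add _ _ _ := rfl
  add_smul a b f := Coind.ext fun x => by
    change f.eval (x * (a + b)) = f.eval (x * a) + f.eval (x * b)
    rw [mul_add, map_add]
  zero_smul f := Coind.ext fun x => by
    change f.eval (x * 0) = 0
    rw [mul_zero, map_zero]

@[simp] theorem Coind.eval_smul (a : A) (f : Coind A V) (x : A) :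
    (a • f).eval x = f.eval (x * a) := rfl

end Coinduction

section UniversalProperties

variable {K A : Type u} [Field K] [Ring A] [Algebra K A] {𝒜 : ℤ → Submodule K A}
  {Am T Ap : Subalgebra K A} {M : Type u} [AddCommGroup M] [Module ↥T M]
  {D : Type u} [AddCommGroup D] [Module A D]

theorem IsProperStandardFor.of_equiv {D' : Type u} [AddCommGroup D'] [Module A D']
    {ι : M →+ D} (h : IsProperStandardFor K A 𝒜 T Ap M D ι) (e : D ≃ₗ[A] D')
    {ι' : M →+ D'} (he : ∀ m, e (ι m) = ι' m) :
    IsProperStandardFor K A 𝒜 T Ap M D' ι' := by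
  refine ⟨fun t m => ?_, fun a ha m => ?_, fun N _ _ f h1 h2 => ?_⟩
  · rw [← he, ← he, h.1, map_smul]
  · rw [← he, ← map_smul, h.2.1 a ha, map_zero]
  · obtain ⟨F, hF, huniq⟩ := h.2.2 N f h1 h2
    refine ⟨F.comp e.symm.toLinearMap, fun m => by simp [← he, hF], fun G hG => ?_⟩
    have := huniq (G.comp e.toLinearMap) fun m => by simp [he, hG]
    rw [← this]
    ext x
    simp

theorem IsProperCostandardFor.of_equiv {D' : Type u} [AddCommGroup D'] [Module A D']
    {p : D →+ M} (h : IsProperCostandardFor K A 𝒜 Am T M D p) (e : D' ≃ₗ[A] D)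
    {p' : D' →+ M} (he : ∀ x, p (e x) = p' x) :
    IsProperCostandardFor K A 𝒜 Am T M D' p' := by
  refine ⟨fun t m => ?_, fun a ha m => ?_, fun N _ _ f h1 h2 => ?_⟩
  · rw [← he, ← he, map_smul, h.1]
  · rw [← he, map_smul, h.2.1 a ha]
  · obtain ⟨F, hF, huniq⟩ := h.2.2 N f h1 h2
    refine ⟨e.symm.toLinearMap.comp F, fun m => by simp [← he, hF], fun G hG => ?_⟩
    have := huniq (e.toLinearMap.comp G) fun m => by simp [he, hG]
    rw [← this]
    ext x
    simp

/-- The defining relations of the proper standard module inside the free module on `M`. -/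
noncomputable def standardRelations (𝒜 : ℤ → Submodule K A) (T Ap : Subalgebra K A) (M : Type u)
    [AddCommGroup M] [Module ↥T M] : Submodule A (M →₀ A) :=
  Submodule.span A
    ({x | ∃ m n : M, x = Finsupp.single (m + n) 1 - Finsupp.single m 1 - Finsupp.single n 1} ∪
      {x | ∃ (t : ↥T) (m : M), x = Finsupp.single (t • m) 1 - (t : A) • Finsupp.single m 1} ∪
      {x | ∃ a ∈ Jpos K A 𝒜 T Ap, ∃ m : M, x = a • Finsupp.single m 1})

theorem exists_properStandard (𝒜 : ℤ → Submodule K A) (T Ap : Subalgebra K A)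
    (M : Type u) [AddCommGroup M] [Module ↥T M] :
    ∃ (D : Type u) (_ : AddCommGroup D) (_ : Module A D) (ι : M →+ D),
      IsProperStandardFor K A 𝒜 T Ap M D ι := by
  set R := standardRelations 𝒜 T Ap M with hR
  have hmem := Submodule.subset_span (R := A) (s := _) |>.trans_eq (congrArg SetLike.coe hR.symm)
  let ι : M →+ ((M →₀ A) ⧸ R) := AddMonoidHom.mk' (fun m => R.mkQ (Finsupp.single m 1)) <| by
    intro m n
    rw [← map_add, ← sub_eq_zero, ← map_sub, Submodule.mkQ_apply,
      Submodule.Quotient.mk_eq_zero, ← sub_sub]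
    exact hmem (Or.inl (Or.inl ⟨m, n, rfl⟩))
  refine ⟨(M →₀ A) ⧸ R, inferInstance, inferInstance, ι, fun t m => ?_, fun a ha m => ?_,
    fun N _ _ f h1 h2 => ?_⟩
  · change R.mkQ _ = (t : A) • R.mkQ _
    rw [← map_smul, ← sub_eq_zero, ← map_sub, Submodule.mkQ_apply, Submodule.Quotient.mk_eq_zero]
    exact hmem (Or.inl (Or.inr ⟨t, m, rfl⟩))
  · change a • R.mkQ _ = 0
    rw [← map_smul, Submodule.mkQ_apply, Submodule.Quotient.mk_eq_zero]
    exact hmem (Or.inr ⟨a, ha, m, rfl⟩)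
  · have hker : R ≤ LinearMap.ker (Finsupp.linearCombination A f) := by
      refine Submodule.span_le.2 ?_
      rintro x ((⟨m, n, rfl⟩ | ⟨t, m, rfl⟩) | ⟨a, ha, m, rfl⟩)
      · simp
      · simp [h1]
      · simp only [SetLike.mem_coe, LinearMap.mem_ker, map_smul,
          Finsupp.linearCombination_single, one_smul, h2 a ha]
    refine ⟨R.liftQ _ hker, fun m => ?_, fun G hG => ?_⟩
    · change R.liftQ _ hker (R.mkQ _) = _
      simp
    · refine Submodule.linearMap_qext _ (Finsupp.lhom_ext' fun m => LinearMap.ext_ring ?_)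
      have := hG m
      change G (R.mkQ _) = _ at this
      simp [← this]

/-- The proper costandard module, as a submodule of the coinduced module. -/
def costandardSubmodule (𝒜 : ℤ → Submodule K A) (Am T : Subalgebra K A) (M : Type u)
    [AddCommGroup M] [Module ↥T M] : Submodule A (Coind A M) where
  carrier := {f | (∀ (t : ↥T) (a : A), f.eval (t * a) = t • f.eval a) ∧
    ∀ j ∈ Jneg K A 𝒜 Am T, ∀ a : A, f.eval (j * a) = 0}
  add_mem' := by
    rintro f g ⟨hf1, hf2⟩ ⟨hg1, hg2⟩
    refine ⟨fun t a => ?_, fun j hj a => ?_⟩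
    · simp [hf1, hg1]
    · simp [hf2 j hj, hg2 j hj]
  zero_mem' := ⟨fun t a => by simp, fun j hj a => by simp⟩
  smul_mem' := by
    rintro c f ⟨hf1, hf2⟩
    refine ⟨fun t a => ?_, fun j hj a => ?_⟩
    · simp [mul_assoc, hf1]
    · simp [mul_assoc, hf2 j hj]

theorem exists_properCostandard (𝒜 : ℤ → Submodule K A) (Am T : Subalgebra K A)
    (M : Type u) [AddCommGroup M] [Module ↥T M] :
    ∃ (D : Type u) (_ : AddCommGroup D) (_ : Module A D) (p : D →+ M),
      IsProperCostandardFor K A 𝒜 Am T M D p := by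
  set C := costandardSubmodule 𝒜 Am T M
  let p : C →+ M := AddMonoidHom.mk' (fun f => (f : Coind A M).eval 1) fun f g => by simp
  have hp : ∀ (a : A) (f : C), p (a • f) = (f : Coind A M).eval a := fun a f => by
    change (a • (f : Coind A M)).eval 1 = _
    simp
  refine ⟨C, inferInstance, inferInstance, p, fun t f => ?_, fun a ha f => ?_,
    fun N _ _ f h1 h2 => ?_⟩
  · rw [hp, ← mul_one (t : A), f.2.1]
    rfl
  · rw [hp, ← mul_one a, f.2.2 a ha]
  · let F : N →ₗ[A] C :=
      { toFun n := ⟨Coind.of (f.comp ((smulAddHom A N).flip n)),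
          fun t a => by simp [mul_smul, h1], fun j hj a => by simp [mul_smul, h2 j hj]⟩
        map_add' m n := Subtype.ext (Coind.ext fun a => by simp)
        map_smul' c n := Subtype.ext (Coind.ext fun a => by simp [mul_smul]) }
    refine ⟨F, fun x => ?_, fun G hG => ?_⟩
    · change f ((1 : A) • x) = f x
      rw [one_smul]
    · refine LinearMap.ext fun x => Subtype.ext (Coind.ext fun a => ?_)
      rw [← hp, ← map_smul, hG]
      rfl

/-- A balanced biadditive map out of `A × M` factors through the proper standard module. -/
theorem IsProperStandardFor.exists_balanced_lift {ι : M →+ D}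
    (h : IsProperStandardFor K A 𝒜 T Ap M D ι) {V : Type u} [AddCommGroup V]
    (β : M →+ A →+ V) (h1 : ∀ (t : ↥T) a m, β m (a * t) = β (t • m) a)
    (h2 : ∀ j ∈ Jpos K A 𝒜 T Ap, ∀ a m, β m (a * j) = 0) :
    ∃ s : D →+ V, ∀ a m, s (a • ι m) = β m a := by
  obtain ⟨F, hF, -⟩ := h.2.2 (Coind A V) β
    (fun t m => Coind.ext fun a => (h1 t a m).symm) (fun j hj m => Coind.ext fun a => h2 j hj a m)
  refine ⟨(AddMonoidHom.eval (1 : A)).comp (Coind.eval.comp F.toAddMonoidHom), fun a m => ?_⟩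
  change (F (a • ι m)).eval 1 = _
  rw [map_smul, Coind.eval_smul, one_mul, hF]
  rfl

theorem IsProperStandardFor.span_range_eq_top {ι : M →+ D}
    (h : IsProperStandardFor K A 𝒜 T Ap M D ι) : Submodule.span A (Set.range ι) = ⊤ := by
  set X := Submodule.span A (Set.range ι)
  obtain ⟨F, -, huniq⟩ := h.2.2 (D ⧸ X) 0 (fun t m => by simp) (fun a _ m => by simp)
  have h0 : (0 : D →ₗ[A] D ⧸ X) = X.mkQ := by
    rw [huniq 0 fun m => rfl, huniq X.mkQ fun m => ?_]
    simpa using Submodule.subset_span (Set.mem_range_self m)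
  rw [← X.ker_mkQ, ← h0, LinearMap.ker_zero]

theorem IsProperStandardFor.induction {ι : M →+ D}
    (h : IsProperStandardFor K A 𝒜 T Ap M D ι) {P : D → Prop} (zero : P 0)
    (add : ∀ x y, P x → P y → P (x + y)) (smul : ∀ (a : A) (m : M), P (a • ι m)) (x : D) :
    P x := by
  have hx : x ∈ Submodule.span A (Set.range ι) := h.span_range_eq_top ▸ Submodule.mem_top
  refine Submodule.closure_induction (p := fun x _ => P x) zero
    (fun x y _ _ => add x y) ?_ hx
  rintro a _ ⟨m, rfl⟩
  exact smul a m

theorem IsProperCostandardFor.hom_ext {p : D →+ M}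
    (h : IsProperCostandardFor K A 𝒜 Am T M D p) {N : Type u} [AddCommGroup N] [Module A N]
    {F G : N →ₗ[A] D} (hFG : ∀ x, p (F x) = p (G x)) : F = G := by
  obtain ⟨H, -, huniq⟩ := h.2.2 N (p.comp G.toAddMonoidHom)
    (fun t x => by simp [h.1]) (fun a ha x => by simp [h.2.1 a ha])
  rw [huniq F hFG, huniq G fun _ => rfl]

end UniversalProperties

section Grading

variable {K A : Type u} [Field K] [Ring A] [Algebra K A]

theorem positive_isNilpotent [FiniteDimensional K A] {𝒜 : ℤ → Submodule K A}
    (hind : iSupIndep 𝒜) (hmul : ∀ i j : ℤ, ∀ a b : A, a ∈ 𝒜 i → b ∈ 𝒜 j → a * b ∈ 𝒜 (i + j))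
    {J : Submodule K A} (hJ : J ≤ ⨆ (i : ℤ) (_ : 0 < i), 𝒜 i) : ∃ n : ℕ, J ^ (n + 1) = ⊥ := by
  have hfin : {i | 𝒜 i ≠ ⊥}.Finite := WellFoundedGT.finite_ne_bot_of_iSupIndep hind
  have hle : ∀ n : ℕ, J ^ (n + 1) ≤ ⨆ (i : ℤ) (_ : (n : ℤ) < i), 𝒜 i := by
    intro n
    induction n with
    | zero => simpa using hJ
    | succ n ih =>
      rw [pow_succ]
      refine (mul_le_mul' ih hJ).trans ?_
      simp only [Submodule.iSup_mul, Submodule.mul_iSup, iSup_le_iff]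
      intro j hj i hi
      refine Submodule.mul_le.2 fun a ha b hb => ?_
      refine Submodule.mem_iSup_of_mem (i + j) (Submodule.mem_iSup_of_mem ?_ (hmul i j a b ha hb))
      push_cast
      omega
  obtain ⟨N, hN⟩ := hfin.bddAbove
  refine ⟨N.toNat, eq_bot_iff.2 ((hle _).trans ?_)⟩
  simp only [iSup_le_iff]
  intro i hi
  by_contra hne
  have := hN (show i ∈ {i | 𝒜 i ≠ ⊥} from fun h0 => hne (h0 ▸ le_rfl))
  omega

theorem negative_isNilpotent [FiniteDimensional K A] {𝒜 : ℤ → Submodule K A}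
    (hind : iSupIndep 𝒜) (hmul : ∀ i j : ℤ, ∀ a b : A, a ∈ 𝒜 i → b ∈ 𝒜 j → a * b ∈ 𝒜 (i + j))
    {J : Submodule K A} (hJ : J ≤ ⨆ (i : ℤ) (_ : i < 0), 𝒜 i) : ∃ n : ℕ, J ^ (n + 1) = ⊥ := by
  refine positive_isNilpotent (𝒜 := fun i => 𝒜 (-i)) (hind.comp neg_injective)
    (fun i j a b ha hb => neg_add i j ▸ hmul _ _ a b ha hb) (hJ.trans ?_)
  simp only [iSup_le_iff]
  intro i hi
  refine le_iSup₂_of_le (-i) (by omega) ?_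
  rw [neg_neg]

theorem exists_proj_zero {𝒜 : ℤ → Submodule K A} (hint : DirectSum.IsInternal 𝒜)
    (hmul : ∀ i j : ℤ, ∀ a b : A, a ∈ 𝒜 i → b ∈ 𝒜 j → a * b ∈ 𝒜 (i + j)) :
    ∃ P : A →ₗ[K] A, (∀ a ∈ 𝒜 0, P a = a) ∧ (∀ i ≠ 0, ∀ a ∈ 𝒜 i, P a = 0) ∧
      (∀ t ∈ 𝒜 0, ∀ a, P (t * a) = t * P a) ∧ (∀ t ∈ 𝒜 0, ∀ a, P (a * t) = P a * t) := by
  let e := LinearEquiv.ofBijective (DirectSum.coeLinearMap 𝒜) hint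
  have he : ∀ i (a : 𝒜 i), e.symm a = DirectSum.lof K ℤ (fun i => 𝒜 i) i a := fun i a => by
    rw [LinearEquiv.symm_apply_eq]
    exact (DirectSum.coeLinearMap_lof 𝒜 i a).symm
  let P := (𝒜 0).subtype ∘ₗ DirectSum.component K ℤ (fun i => 𝒜 i) 0 ∘ₗ e.symm.toLinearMap
  have h0 : ∀ a ∈ 𝒜 0, P a = a := fun a ha => by
    simp [P, he 0 ⟨a, ha⟩, DirectSum.component.lof_self]
  have h1 : ∀ i ≠ 0, ∀ a ∈ 𝒜 i, P a = 0 := fun i hi a ha => by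
    simp [P, he i ⟨a, ha⟩, DirectSum.component.of, hi]
  have htop : ∀ a : A, a ∈ ⨆ i, 𝒜 i := fun a => hint.submodule_iSup_eq_top ▸ Submodule.mem_top
  refine ⟨P, h0, h1, fun t ht a => ?_, fun t ht a => ?_⟩
  · induction htop a using Submodule.iSup_induction' with
    | mem i a ha =>
      have := hmul 0 i t a ht ha
      rw [zero_add] at this
      by_cases hi : i = 0
      · subst hi
        rw [h0 _ this, h0 _ ha]
      · rw [h1 i hi _ this, h1 i hi _ ha, mul_zero]
    | zero => simp
    | add x y _ _ hx hy => rw [mul_add, map_add, map_add, hx, hy, mul_add]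
  · induction htop a using Submodule.iSup_induction' with
    | mem i a ha =>
      have := hmul i 0 a t ha ht
      rw [add_zero] at this
      by_cases hi : i = 0
      · subst hi
        rw [h0 _ this, h0 _ ha]
      · rw [h1 i hi _ this, h1 i hi _ ha, zero_mul]
    | zero => simp
    | add x y _ _ hx hy => rw [add_mul, map_add, map_add, hx, hy, add_mul]

end Grading

namespace TriangularDecomposition

variable {K A : Type u} [Field K] [Ring A] [Algebra K A] {𝒜 : ℤ → Submodule K A}
  {Am T Ap : Subalgebra K A}

theorem Ap_inf_eq_bot (h : TriangularDecomposition K A 𝒜 Am T Ap) {i : ℤ} (hi : i < 0) :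
    Ap.toSubmodule ⊓ 𝒜 i = ⊥ := by
  refine eq_bot_iff.2 fun x hx => ?_
  have hd := h.internal.submodule_iSupIndep.disjoint_biSup (y := {j : ℤ | 0 ≤ j})
    (x := i) (by simpa using hi)
  refine (hd.le_bot ⟨hx.2, ?_⟩ : x ∈ (⊥ : Submodule K A))
  refine (iSup_le fun n => ?_ : (⨆ n : ℕ, 𝒜 (n : ℤ)) ≤ _) (h.pos_supp hx.1)
  exact le_iSup₂_of_le (n : ℤ) (by simp) le_rfl

theorem Am_inf_eq_bot (h : TriangularDecomposition K A 𝒜 Am T Ap) {i : ℤ} (hi : 0 < i) :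
    Am.toSubmodule ⊓ 𝒜 i = ⊥ := by
  refine eq_bot_iff.2 fun x hx => ?_
  have hd := h.internal.submodule_iSupIndep.disjoint_biSup (y := {j : ℤ | j ≤ 0})
    (x := i) (by simpa using hi)
  refine (hd.le_bot ⟨hx.2, ?_⟩ : x ∈ (⊥ : Submodule K A))
  refine (iSup_le fun n => ?_ : (⨆ n : ℕ, 𝒜 (-(n : ℤ))) ≤ _) (h.neg_supp hx.1)
  exact le_iSup₂_of_le (-(n : ℤ)) (by simp) le_rfl

theorem induction_Ap (h : TriangularDecomposition K A 𝒜 Am T Ap) {P : A → Prop}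
    (scalar : ∀ c : K, P (algebraMap K A c))
    (pos : ∀ i : ℤ, 0 < i → ∀ x ∈ Ap, x ∈ 𝒜 i → P x)
    (add : ∀ x y, P x → P y → P (x + y)) {x : A} (hx : x ∈ Ap) : P x := by
  have hx' : x ∈ Ap.toSubmodule := hx
  rw [h.pos_graded] at hx'
  refine Submodule.iSup_induction _ (motive := P) hx' (fun i x hx => ?_) ?_ add
  · rcases lt_trichotomy i 0 with hi | rfl | hi
    · rw [h.Ap_inf_eq_bot hi, Submodule.mem_bot] at hx
      rw [hx, ← map_zero (algebraMap K A)]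
      exact scalar 0
    · rw [h.pos_deg0, Submodule.mem_span_singleton] at hx
      obtain ⟨c, rfl⟩ := hx
      rw [← Algebra.algebraMap_eq_smul_one]
      exact scalar c
    · exact pos i hi x hx.1 hx.2
  · rw [← map_zero (algebraMap K A)]
    exact scalar 0

theorem induction_Am (h : TriangularDecomposition K A 𝒜 Am T Ap) {P : A → Prop}
    (scalar : ∀ c : K, P (algebraMap K A c))
    (neg : ∀ i : ℤ, i < 0 → ∀ x ∈ Am, x ∈ 𝒜 i → P x)
    (add : ∀ x y, P x → P y → P (x + y)) {x : A} (hx : x ∈ Am) : P x := by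
  have hx' : x ∈ Am.toSubmodule := hx
  rw [h.neg_graded] at hx'
  refine Submodule.iSup_induction _ (motive := P) hx' (fun i x hx => ?_) ?_ add
  · rcases lt_trichotomy i 0 with hi | rfl | hi
    · exact neg i hi x hx.1 hx.2
    · rw [h.neg_deg0, Submodule.mem_span_singleton] at hx
      obtain ⟨c, rfl⟩ := hx
      rw [← Algebra.algebraMap_eq_smul_one]
      exact scalar c
    · rw [h.Am_inf_eq_bot hi, Submodule.mem_bot] at hx
      rw [hx, ← map_zero (algebraMap K A)]
      exact scalar 0
  · rw [← map_zero (algebraMap K A)]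
    exact scalar 0

theorem T_le_Bneg : T.toSubmodule ≤ Bneg K A Am T := by
  simpa [Bneg] using mul_le_mul_left (Submodule.one_le.2 Am.one_mem) T.toSubmodule

theorem Bneg_mul_Bneg (h : TriangularDecomposition K A 𝒜 Am T Ap) :
    Bneg K A Am T * Bneg K A Am T = Bneg K A Am T := by
  rw [Bneg]
  nth_rw 2 [h.comm_neg]
  rw [mul_assoc, ← mul_assoc T.toSubmodule, T.isIdempotentElem_toSubmodule, ← h.comm_neg,
    ← mul_assoc, Am.isIdempotentElem_toSubmodule]

theorem Bpos_mul_Bpos (h : TriangularDecomposition K A 𝒜 Am T Ap) :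
    Bpos K A T Ap * Bpos K A T Ap = Bpos K A T Ap := by
  rw [Bpos]
  nth_rw 2 [h.comm_pos]
  rw [mul_assoc, ← mul_assoc T.toSubmodule, T.isIdempotentElem_toSubmodule, ← h.comm_pos,
    ← mul_assoc, Ap.isIdempotentElem_toSubmodule]

theorem Jneg_le_Bneg : Jneg K A 𝒜 Am T ≤ Bneg K A Am T :=
  iSup₂_le fun _ _ => inf_le_left

theorem T_mul_Jneg (h : TriangularDecomposition K A 𝒜 Am T Ap) :
    T.toSubmodule * Jneg K A 𝒜 Am T ≤ Jneg K A 𝒜 Am T := by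
  rw [Jneg]
  simp only [Submodule.mul_iSup]
  refine iSup₂_mono fun i _ => Submodule.mul_le.2 fun t ht b hb => ⟨?_, ?_⟩
  · exact h.Bneg_mul_Bneg.le (Submodule.mul_mem_mul (T_le_Bneg ht) hb.1)
  · exact zero_add i ▸ h.mul_mem 0 i t b (h.T_deg0 ht) hb.2

theorem T_le_Bpos : T.toSubmodule ≤ Bpos K A T Ap := by
  simpa [Bpos] using mul_le_mul_left (Submodule.one_le.2 Ap.one_mem) T.toSubmodule

theorem Ap_le_Bpos : Ap.toSubmodule ≤ Bpos K A T Ap := by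
  simpa [Bpos] using mul_le_mul_right (Submodule.one_le.2 T.one_mem) Ap.toSubmodule

theorem Jpos_mul_T (h : TriangularDecomposition K A 𝒜 Am T Ap) :
    Jpos K A 𝒜 T Ap * T.toSubmodule ≤ Jpos K A 𝒜 T Ap := by
  rw [Jpos]
  simp only [Submodule.iSup_mul]
  refine iSup₂_mono fun i _ => Submodule.mul_le.2 fun b hb t ht => ⟨?_, ?_⟩
  · exact h.Bpos_mul_Bpos.le (Submodule.mul_mem_mul hb.1 (T_le_Bpos ht))
  · exact add_zero i ▸ h.mul_mem i 0 b t hb.2 (h.T_deg0 ht)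

/-- `B⁻ = T + J⁻`. -/
theorem Bneg_le_sup (h : TriangularDecomposition K A 𝒜 Am T Ap) :
    Bneg K A Am T ≤ T.toSubmodule ⊔ Jneg K A 𝒜 Am T := by
  refine Submodule.mul_le.2 fun a ha t ht => ?_
  refine h.induction_Am (P := fun a => a * t ∈ T.toSubmodule ⊔ Jneg K A 𝒜 Am T)
    (fun c => ?_) (fun i hi x hx hxi => ?_) (fun x y hx hy => ?_) ha
  · rw [← Algebra.smul_def]
    exact Submodule.smul_mem _ _ (Submodule.mem_sup_left ht)
  · refine Submodule.mem_sup_right (Submodule.mem_iSup_of_mem i (Submodule.mem_iSup_of_mem hi ?_))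
    exact ⟨Submodule.mul_mem_mul hx ht, add_zero i ▸ h.mul_mem i 0 x t hxi (h.T_deg0 ht)⟩
  · rw [add_mul]
    exact add_mem hx hy

/-- `A = B⁻ + A J⁺`; moreover the projection onto `B⁻` along `A J⁺` is a map of
`(B⁻, T)`-bimodules, and it can be followed by the degree zero projection `B⁻ → T`. -/
theorem exists_projections (h : TriangularDecomposition K A 𝒜 Am T Ap) :
    ∃ Θ P : A →ₗ[K] A, (∀ a, Θ a ∈ Bneg K A Am T) ∧ (∀ a, a - Θ a ∈ ⊤ * Jpos K A 𝒜 T Ap) ∧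
      (∀ b ∈ Bneg K A Am T, ∀ a, Θ (b * a) = b * Θ a) ∧ (∀ t ∈ T, ∀ a, Θ (a * t) = Θ a * t) ∧
      (∀ j ∈ Jpos K A 𝒜 T Ap, ∀ a, Θ (a * j) = 0) ∧ Θ 1 = 1 ∧
      (∀ a, P (Θ a) ∈ T) ∧ (∀ t ∈ T, P t = t) ∧ (∀ t ∈ T, ∀ a, P (t * a) = t * P a) ∧
      (∀ t ∈ T, ∀ a, P (a * t) = P a * t) := by
  obtain ⟨P, P0, P1, Pl, Pr⟩ := exists_proj_zero h.internal h.mul_mem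
  have hT : ∀ t ∈ T, t ∈ 𝒜 0 := fun t ht => h.T_deg0 ht
  let e := LinearEquiv.ofBijective _ h.mul_bij
  let Θ : A →ₗ[K] A := LinearMap.mul' K A ∘ₗ
    TensorProduct.map (mulMap K A Am.toSubmodule T.toSubmodule) (P ∘ₗ Ap.toSubmodule.subtype) ∘ₗ
      e.symm.toLinearMap
  have hΘ0 : ∀ a ∈ Am, ∀ t ∈ T, ∀ x ∈ Ap, Θ (a * t * x) = a * t * P x := by
    intro a ha t ht x hx
    have : e.symm (a * t * x) = ((⟨a, ha⟩ : Am.toSubmodule) ⊗ₜ[K] (⟨t, ht⟩ : T.toSubmodule)) ⊗ₜ[K]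
        (⟨x, hx⟩ : Ap.toSubmodule) := by
      rw [LinearEquiv.symm_apply_eq]
      simp [e, triMulMap, mulMap]
    simp [Θ, this, mulMap]
  have hΘ1 : ∀ b ∈ Bneg K A Am T, ∀ x ∈ Ap, Θ (b * x) = b * P x := by
    intro b hb x hx
    refine Submodule.mul_induction_on hb (fun a ha t ht => hΘ0 a ha t ht x hx) fun y z hy hz => ?_
    rw [add_mul, map_add, hy, hz, add_mul]
  have hΘ : ∀ b ∈ Bneg K A Am T, ∀ x ∈ Bpos K A T Ap, Θ (b * x) = b * P x := by
    intro b hb x hx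
    rw [Bpos, h.comm_pos] at hx
    refine Submodule.mul_induction_on hx (fun t ht a ha => ?_) fun y z hy hz => ?_
    · rw [← mul_assoc, hΘ1 _ (h.Bneg_mul_Bneg.le (Submodule.mul_mem_mul hb (T_le_Bneg ht))) a ha,
        Pl t (hT t ht), mul_assoc]
    · rw [mul_add, map_add, hy, hz, map_add, mul_add]
  have hind : ∀ {Q : A → Prop}, (∀ b ∈ Bneg K A Am T, ∀ x ∈ Ap, Q (b * x)) →
      (∀ x y, Q x → Q y → Q (x + y)) → ∀ a, Q a := by
    intro Q hQ hadd a
    have ha : a ∈ Bneg K A Am T * Ap.toSubmodule := by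
      obtain ⟨w, rfl⟩ := h.mul_bij.2 a
      induction w using TensorProduct.induction_on with
      | zero => simp
      | add x y hx hy => rw [map_add]; exact add_mem hx hy
      | tmul w x =>
        have : mulMap K A Am.toSubmodule T.toSubmodule w ∈ Bneg K A Am T := by
          induction w using TensorProduct.induction_on with
          | zero => simp
          | add x y hx hy => rw [map_add]; exact add_mem hx hy
          | tmul a t => exact Submodule.mul_mem_mul a.2 t.2
        simpa [triMulMap] using Submodule.mul_mem_mul this x.2
    exact Submodule.mul_induction_on ha hQ hadd
  have hPAp : ∀ x ∈ Ap, ∃ c : K, P x = algebraMap K A c := by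
    intro x hx
    refine h.induction_Ap (P := fun x => ∃ c : K, P x = algebraMap K A c) (fun c => ⟨c, ?_⟩)
      (fun i hi x _ hxi => ⟨0, ?_⟩) (fun x y hx hy => ?_) hx
    · rw [Algebra.algebraMap_eq_smul_one, map_smul, P0 1 h.one_mem]
    · rw [P1 i hi.ne' x hxi, map_zero]
    · obtain ⟨⟨c, hc⟩, ⟨d, hd⟩⟩ := And.intro hx hy
      exact ⟨c + d, by rw [map_add, map_add, hc, hd]⟩
  have hmulP : ∀ b ∈ Bneg K A Am T, ∀ x ∈ Ap, b * P x ∈ Bneg K A Am T := by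
    intro b hb x hx
    obtain ⟨c, hc⟩ := hPAp x hx
    rw [hc, ← Algebra.commutes, ← Algebra.smul_def]
    exact Submodule.smul_mem _ _ hb
  have h1B : (1 : A) ∈ Bneg K A Am T := T_le_Bneg (T.one_mem)
  have hΘB : ∀ a, Θ a ∈ Bneg K A Am T := by
    refine hind (fun b hb x hx => ?_) fun x y hx hy => ?_
    · rw [hΘ1 b hb x hx]
      exact hmulP b hb x hx
    · rw [map_add]
      exact add_mem hx hy
  have hPB : ∀ b ∈ Bneg K A Am T, P b ∈ T := by
    intro b hb
    obtain ⟨t, ht, j, hj, rfl⟩ := Submodule.mem_sup.1 (h.Bneg_le_sup hb)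
    have hPj : P j = 0 := by
      refine (iSup₂_le fun i hi x hx => ?_ : Jneg K A 𝒜 Am T ≤ LinearMap.ker P) hj
      exact P1 i hi.ne x hx.2
    rw [map_add, P0 t (hT t ht), hPj, add_zero]
    exact ht
  refine ⟨Θ, P, hΘB, ?_, ?_, ?_, ?_, ?_, fun a => hPB _ (hΘB a), fun t ht => P0 t (hT t ht),
    fun t ht => Pl t (hT t ht), fun t ht => Pr t (hT t ht)⟩
  · refine hind (fun b hb x hx => ?_) fun x y hx hy => ?_
    · rw [hΘ1 b hb x hx, ← mul_sub]
      refine Submodule.mul_mem_mul Submodule.mem_top ?_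
      refine h.induction_Ap (P := fun x => x - P x ∈ Jpos K A 𝒜 T Ap) (fun c => ?_)
        (fun i hi x hx hxi => ?_) (fun x y hx hy => ?_) hx
      · rw [Algebra.algebraMap_eq_smul_one, map_smul, P0 1 h.one_mem, sub_self]
        exact zero_mem _
      · rw [P1 i hi.ne' x hxi, sub_zero]
        exact Submodule.mem_iSup_of_mem i (Submodule.mem_iSup_of_mem hi ⟨Ap_le_Bpos hx, hxi⟩)
      · rw [map_add, add_sub_add_comm]
        exact add_mem hx hy
    · rw [map_add, add_sub_add_comm]
      exact add_mem hx hy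
  · intro b hb
    refine hind (fun b' hb' x hx => ?_) fun x y hx hy => ?_
    · rw [← mul_assoc, hΘ1 _ (h.Bneg_mul_Bneg.le (Submodule.mul_mem_mul hb hb')) x hx,
        hΘ1 b' hb' x hx, mul_assoc]
    · rw [mul_add, map_add, hx, hy, map_add, mul_add]
  · intro t ht
    refine hind (fun b hb x hx => ?_) fun x y hx hy => ?_
    · rw [mul_assoc, hΘ b hb _ (Submodule.mul_mem_mul hx ht), Pr t (hT t ht), hΘ1 b hb x hx,
        mul_assoc]
    · rw [add_mul, map_add, hx, hy, map_add, add_mul]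
  · intro j hj
    refine hind (fun b hb x hx => ?_) fun x y hx hy => ?_
    · have hPxj : j ∈ LinearMap.ker (Θ ∘ₗ LinearMap.mulLeft K (b * x)) := by
        refine (iSup₂_le fun i hi j hj => ?_ : Jpos K A 𝒜 T Ap ≤ _) hj
        rw [LinearMap.mem_ker, LinearMap.comp_apply, LinearMap.mulLeft_apply, mul_assoc,
          hΘ b hb _ (h.Bpos_mul_Bpos.le (Submodule.mul_mem_mul (Ap_le_Bpos hx) hj.1))]
        have : P (x * j) = 0 := by
          refine h.induction_Ap (P := fun x => P (x * j) = 0) (fun c => ?_)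
            (fun k hk x _ hxk => ?_) (fun x y hx hy => ?_) hx
          · rw [← Algebra.smul_def, map_smul, P1 i hi.ne' j hj.2, smul_zero]
          · exact P1 (k + i) (by omega) _ (h.mul_mem k i x j hxk hj.2)
          · rw [add_mul, map_add, hx, hy, add_zero]
        rw [this, mul_zero]
      exact hPxj
    · rw [add_mul, map_add, hx, hy, add_zero]
  · rw [← mul_one (1 : A), hΘ1 1 h1B 1 (Ap.one_mem), P0 1 h.one_mem]

theorem Jpos_nilpotent [FiniteDimensional K A] (h : TriangularDecomposition K A 𝒜 Am T Ap) :
    ∃ n : ℕ, Jpos K A 𝒜 T Ap ^ (n + 1) = ⊥ :=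
  positive_isNilpotent h.internal.submodule_iSupIndep h.mul_mem
    (iSup₂_mono fun _ _ => inf_le_right)

theorem Jneg_nilpotent [FiniteDimensional K A] (h : TriangularDecomposition K A 𝒜 Am T Ap) :
    ∃ n : ℕ, Jneg K A 𝒜 Am T ^ (n + 1) = ⊥ :=
  negative_isNilpotent h.internal.submodule_iSupIndep h.mul_mem
    (iSup₂_mono fun _ _ => inf_le_right)

end TriangularDecomposition

section Nakayama

variable {K A : Type u} [Field K] [Ring A] [Algebra K A] {J : Submodule K A}
  {X : Type u} [AddCommGroup X] [Module A X]

/-- The additive subgroup `J X` of an `A`-module `X`. -/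
def smulSubgroup (J : Submodule K A) (X : Type u) [AddCommGroup X] [Module A X] : AddSubgroup X :=
  AddSubgroup.closure {x | ∃ j ∈ J, ∃ y : X, x = j • y}

theorem smul_mem_smulSubgroup {j : A} (hj : j ∈ J) (x : X) : j • x ∈ smulSubgroup J X :=
  AddSubgroup.subset_closure ⟨j, hj, x, rfl⟩

theorem smulSubgroup_le {Y : AddSubgroup X} (hY : ∀ j ∈ J, ∀ x : X, j • x ∈ Y) :
    smulSubgroup J X ≤ Y := by
  refine (AddSubgroup.closure_le _).2 ?_
  rintro _ ⟨j, hj, y, rfl⟩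
  exact hY j hj y

theorem smul_eq_zero_of_annihilated {x : X} (hx : ∀ j ∈ J, j • x = 0) {c : A}
    (hc : c ∈ (⊤ : Submodule K A) * J) : c • x = 0 := by
  refine Submodule.mul_induction_on hc (fun a _ j hj => ?_) fun y z hy hz => ?_
  · rw [mul_smul, hx j hj, smul_zero]
  · rw [add_smul, hy, hz, add_zero]

theorem exists_ne_zero_annihilated {n : ℕ} (hJ : J ^ n = ⊥) [Nontrivial X] :
    ∃ x : X, x ≠ 0 ∧ ∀ j ∈ J, j • x = 0 := by
  by_contra! hcon
  have : ∀ n : ℕ, ∃ a ∈ J ^ n, ∃ x : X, a • x ≠ 0 := by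
    intro n
    induction n with
    | zero =>
      obtain ⟨x, hx⟩ := exists_ne (0 : X)
      exact ⟨1, Submodule.one_le.1 (pow_zero J).ge, x, by simpa using hx⟩
    | succ n ih =>
      obtain ⟨a, ha, x, hx⟩ := ih
      obtain ⟨j, hj, hjx⟩ := hcon _ hx
      exact ⟨j * a, pow_succ' J n ▸ Submodule.mul_mem_mul hj ha, x, by rwa [mul_smul]⟩
  obtain ⟨a, ha, x, hx⟩ := this n
  rw [hJ, Submodule.mem_bot] at ha
  simp [ha] at hx

theorem smulSubgroup_ne_top {n : ℕ} (hJ : J ^ n = ⊥) [Nontrivial X] : smulSubgroup J X ≠ ⊤ := by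
  intro htop
  have : ∀ n : ℕ, smulSubgroup (J ^ n) X = ⊤ := by
    intro n
    induction n with
    | zero =>
      refine eq_top_iff.2 fun x _ => ?_
      rw [← one_smul A x]
      exact smul_mem_smulSubgroup (Submodule.one_le.1 (pow_zero J).ge) x
    | succ n ih =>
      rw [← top_le_iff, ← ih]
      refine smulSubgroup_le fun a ha x => ?_
      have hx : x ∈ smulSubgroup J X := htop ▸ AddSubgroup.mem_top x
      refine AddSubgroup.closure_induction
        (p := fun x _ => a • x ∈ smulSubgroup (J ^ (n + 1)) X) ?_ ?_ ?_ ?_ hx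
      · rintro _ ⟨j, hj, y, rfl⟩
        rw [← mul_smul]
        exact smul_mem_smulSubgroup (pow_succ J n ▸ Submodule.mul_mem_mul ha hj) y
      · simp
      · intro x y _ _ hx hy
        rw [smul_add]
        exact add_mem hx hy
      · intro x _ hx
        rw [smul_neg]
        exact neg_mem hx
  obtain ⟨x, hx⟩ := exists_ne (0 : X)
  have hx' : x ∈ smulSubgroup (J ^ n) X := this n ▸ AddSubgroup.mem_top x
  rw [hJ] at hx'
  have : smulSubgroup (⊥ : Submodule K A) X ≤ ⊥ := smulSubgroup_le fun j hj y => by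
    simp [(Submodule.mem_bot K).1 hj]
  exact hx (this hx')

theorem eq_top_of_sup_smulSubgroup {n : ℕ} (hJ : J ^ n = ⊥) {Y : Submodule A X}
    (hY : Y.toAddSubgroup ⊔ smulSubgroup J X = ⊤) : Y = ⊤ := by
  by_contra hne
  have := Submodule.Quotient.nontrivial_iff.2 hne
  refine smulSubgroup_ne_top (X := X ⧸ Y) hJ (eq_top_iff.2 fun x _ => ?_)
  obtain ⟨x, rfl⟩ := Y.mkQ_surjective x
  have hle : smulSubgroup J X ≤ (smulSubgroup J (X ⧸ Y)).comap Y.mkQ.toAddMonoidHom :=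
    smulSubgroup_le fun j hj x => by
      rw [AddSubgroup.mem_comap]
      exact (map_smul Y.mkQ j x) ▸ smul_mem_smulSubgroup hj _
  have hx : x ∈ Y.toAddSubgroup ⊔ smulSubgroup J X := hY ▸ AddSubgroup.mem_top x
  obtain ⟨y, hy, z, hz, rfl⟩ := AddSubgroup.mem_sup.1 hx
  have hy0 : Y.mkQ y = 0 := by simpa using hy
  rw [map_add, hy0, zero_add]
  exact hle hz

end Nakayama

section Simple

variable {K A : Type u} [Field K] [Ring A] [Algebra K A]
  {𝒜 : ℤ → Submodule K A} {Am T Ap : Subalgebra K A}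

/-- The `T`-submodule of `J⁺`-invariants of an `A`-module. -/
def invariants (h : TriangularDecomposition K A 𝒜 Am T Ap) (X : Type u) [AddCommGroup X]
    [Module A X] : Submodule ↥T X where
  carrier := {x | ∀ j ∈ Jpos K A 𝒜 T Ap, j • x = 0}
  add_mem' hx hy j hj := by rw [smul_add, hx j hj, hy j hj, add_zero]
  zero_mem' j _ := smul_zero j
  smul_mem' t x hx j hj := by
    rw [Subalgebra.smul_def, ← mul_smul]
    exact hx _ (h.Jpos_mul_T (Submodule.mul_mem_mul hj t.2))

/-- The `T`-submodule `J⁻ X` of an `A`-module `X`. -/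
noncomputable def smulJneg (h : TriangularDecomposition K A 𝒜 Am T Ap) (X : Type u) [AddCommGroup X]
    [Module A X] : Submodule ↥T X where
  __ := smulSubgroup (Jneg K A 𝒜 Am T) X
  smul_mem' t x hx := by
    refine (smulSubgroup_le fun j hj x => ?_ : smulSubgroup (Jneg K A 𝒜 Am T) X ≤
      (smulSubgroup (Jneg K A 𝒜 Am T) X).comap (DistribSMul.toAddMonoidHom X t)) hx
    rw [AddSubgroup.mem_comap, DistribSMul.toAddMonoidHom_apply, Subalgebra.smul_def, ← mul_smul]
    exact smul_mem_smulSubgroup (h.T_mul_Jneg (Submodule.mul_mem_mul t.2 hj)) x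

theorem smulJneg_ne_top [FiniteDimensional K A] (h : TriangularDecomposition K A 𝒜 Am T Ap)
    (X : Type u) [AddCommGroup X] [Module A X] [Nontrivial X] : smulJneg h X ≠ ⊤ := by
  obtain ⟨n, hn⟩ := h.Jneg_nilpotent
  exact fun he => smulSubgroup_ne_top (X := X) hn
    (eq_top_iff.2 fun x _ => (he ▸ Submodule.mem_top : x ∈ smulJneg h X))

theorem exists_isProperStandardFor [FiniteDimensional K A]
    (h : TriangularDecomposition K A 𝒜 Am T Ap) [IsSemisimpleRing ↥T]
    (hs : ∀ (M : Type u) (_ : AddCommGroup M) (_ : Module ↥T M), IsSimpleModule ↥T M →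
      ∀ (D : Type u) (_ : AddCommGroup D) (_ : Module A D) (ι : M →+ D),
        IsProperStandardFor K A 𝒜 T Ap M D ι → IsSimpleModule A D)
    (D : Type u) [AddCommGroup D] [Module A D] [IsSimpleModule A D] :
    ∃ (M : Type u) (_ : AddCommGroup M) (_ : Module ↥T M) (ι : M →+ D),
      IsProperStandardFor K A 𝒜 T Ap M D ι := by
  have := IsSimpleModule.nontrivial A D
  obtain ⟨n, hn⟩ := h.Jpos_nilpotent
  obtain ⟨x, hx0, hx⟩ := exists_ne_zero_annihilated (X := D) hn
  have : Nontrivial (invariants h D) := ⟨⟨x, hx⟩, 0, fun he => hx0 (congrArg Subtype.val he)⟩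
  obtain ⟨M, hM⟩ := IsSemisimpleModule.exists_simple_submodule (↥T) (invariants h D)
  have := IsSimpleModule.nontrivial (↥T) M
  obtain ⟨D₀, _, _, ι₀, h₀⟩ := exists_properStandard 𝒜 T Ap M
  have := hs M _ _ hM D₀ _ _ ι₀ h₀
  let ι : M →+ D := (invariants h D).subtype.toAddMonoidHom.comp M.subtype.toAddMonoidHom
  obtain ⟨F, hF, -⟩ := h₀.2.2 D ι (fun t m => rfl) (fun a ha m => m.1.2 a ha)
  have hF0 : F ≠ 0 := by
    rintro rfl
    obtain ⟨m, hm⟩ := exists_ne (0 : M)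
    exact hm (Subtype.ext (Subtype.ext (hF m).symm))
  exact ⟨M, inferInstance, inferInstance, ι,
    h₀.of_equiv (LinearEquiv.ofBijective F (LinearMap.bijective_of_ne_zero hF0)) hF⟩

theorem exists_isProperCostandardFor [FiniteDimensional K A]
    (h : TriangularDecomposition K A 𝒜 Am T Ap) [IsSemisimpleRing ↥T]
    (hs : ∀ (M : Type u) (_ : AddCommGroup M) (_ : Module ↥T M), IsSimpleModule ↥T M →
      ∀ (D : Type u) (_ : AddCommGroup D) (_ : Module A D) (p : D →+ M),
        IsProperCostandardFor K A 𝒜 Am T M D p → IsSimpleModule A D)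
    (D : Type u) [AddCommGroup D] [Module A D] [IsSimpleModule A D] :
    ∃ (M : Type u) (_ : AddCommGroup M) (_ : Module ↥T M) (p : D →+ M),
      IsProperCostandardFor K A 𝒜 Am T M D p := by
  have := IsSimpleModule.nontrivial A D
  have : IsCoatomic (Submodule ↥T D) := isCoatomic_of_isAtomic_of_complementedLattice_of_isModular
  obtain ⟨W, hW, hle⟩ := (eq_top_or_exists_le_coatom (smulJneg h D)).resolve_left
    (smulJneg_ne_top h D)
  have hM : IsSimpleModule ↥T (D ⧸ W) := isSimpleModule_iff_isCoatom.2 hW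
  obtain ⟨D₀, _, _, p₀, h₀⟩ := exists_properCostandard 𝒜 Am T (D ⧸ W)
  have := hs _ _ _ hM D₀ _ _ p₀ h₀
  let p : D →+ D ⧸ W := W.mkQ.toAddMonoidHom
  obtain ⟨F, hF, -⟩ := h₀.2.2 D p (fun t x => rfl) (fun a ha x =>
    (Submodule.Quotient.mk_eq_zero W).2 (hle (smul_mem_smulSubgroup ha x)))
  have hF0 : F ≠ 0 := by
    rintro rfl
    refine hW.1 (eq_top_iff.2 fun x _ => (Submodule.Quotient.mk_eq_zero W).1 ?_)
    exact (hF x).symm.trans (map_zero p₀)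
  exact ⟨D ⧸ W, inferInstance, inferInstance, p,
    h₀.of_equiv (LinearEquiv.ofBijective F (LinearMap.bijective_of_ne_zero hF0)) hF⟩

/-- The vanishing of `Ext¹(Δ̄(M), ∇̄(N))` over a semisimple `T`, as an extension property. -/
theorem exists_extension (h : TriangularDecomposition K A 𝒜 Am T Ap) [IsSemisimpleRing ↥T]
    {M N D S X U : Type u} [AddCommGroup M] [Module ↥T M] [AddCommGroup N] [Module ↥T N]
    [AddCommGroup D] [Module A D] [AddCommGroup S] [Module A S] [AddCommGroup X] [Module A X]
    [AddCommGroup U] [Module A U] {ι : M →+ D} (hD : IsProperStandardFor K A 𝒜 T Ap M D ι)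
    {p : S →+ N} (hS : IsProperCostandardFor K A 𝒜 Am T N S p)
    {i : X →ₗ[A] U} {π : U →ₗ[A] D} (hi : Function.Injective i) (hπ : Function.Surjective π)
    (hex : Function.Exact i π) (f : X →ₗ[A] S) : ∃ F : U →ₗ[A] S, F ∘ₗ i = f := by
  obtain ⟨Θ, -, hΘB, hΘJ, hΘl, hΘr, hΘ0, hΘ1, -⟩ := h.exists_projections
  have := Module.projective_of_isSemisimpleRing (↥T) M
  let ιT : M →ₗ[↥T] D := { ι with map_smul' := hD.1 }
  let πT : U →ₗ[↥T] D := { π with map_smul' := fun t x => map_smul π (t : A) x }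
  obtain ⟨g, hg⟩ := Module.projective_lifting_property πT ιT hπ
  have hg' : ∀ m, π (g m) = ι m := fun m => LinearMap.congr_fun hg m
  let β : M →+ A →+ U := ((smulAddHom A U).comp Θ.toAddMonoidHom).flip.comp g.toAddMonoidHom
  have hβ : ∀ m a, β m a = Θ a • g m := fun _ _ => rfl
  obtain ⟨s, hs⟩ := hD.exists_balanced_lift β
    (fun t a m => by rw [hβ, hβ, hΘr t t.2, mul_smul, map_smul]; rfl)
    (fun j hj a m => by rw [hβ, hΘ0 j hj, zero_smul])
  simp only [hβ] at hs
  have hsB : ∀ b ∈ Bneg K A Am T, ∀ d, s (b • d) = b • s d := by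
    intro b hb d
    refine hD.induction (P := fun d => s (b • d) = b • s d) (by simp) (fun x y hx hy => ?_)
      (fun a m => ?_) d
    · rw [smul_add, map_add, hx, hy, map_add, smul_add]
    · rw [← mul_smul, hs, hs, hΘl b hb, mul_smul]
  have hπs : ∀ d, π (s d) = d := by
    intro d
    refine hD.induction (P := fun d => π (s d) = d) (by simp) (fun x y hx hy => ?_)
      (fun a m => ?_) d
    · rw [map_add, map_add, hx, hy]
    · rw [hs, map_smul, hg', ← sub_eq_zero, ← sub_smul, ← neg_sub, neg_smul,
        smul_eq_zero_of_annihilated (hD.2.1 · · m) (hΘJ a), neg_zero]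
  have hr : ∀ u, ∃ x, i x = u - s (π u) := fun u =>
    (hex _).1 (by rw [map_sub, hπs, sub_self])
  choose r hr using hr
  have hrB : ∀ b ∈ Bneg K A Am T, ∀ u, r (b • u) = b • r u := fun b hb u => hi <| by
    rw [map_smul, hr, hr, map_smul, hsB b hb, smul_sub]
  let φ : U →+ N := (p.comp f.toAddMonoidHom).comp <| AddMonoidHom.mk' r fun u v => hi <| by
    rw [map_add, hr, hr, hr, map_add, map_add, add_sub_add_comm]
  have hφ : ∀ u, φ u = p (f (r u)) := fun _ => rfl
  obtain ⟨F, hF, -⟩ := hS.2.2 U φ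
    (fun t u => by
      rw [hφ, hφ, hrB t (TriangularDecomposition.T_le_Bneg t.2), map_smul, hS.1])
    (fun a ha u => by
      rw [hφ, hrB a (TriangularDecomposition.Jneg_le_Bneg ha), map_smul, hS.2.1 a ha])
  refine ⟨F, hS.hom_ext fun x => ?_⟩
  rw [LinearMap.comp_apply, hF, hφ]
  congr 2
  exact hi (by rw [hr, hex.apply_apply_eq_zero, map_zero, sub_zero])

theorem isSemisimpleRing_of_simple [FiniteDimensional K A]
    (h : TriangularDecomposition K A 𝒜 Am T Ap) [IsSemisimpleRing ↥T]
    (hΔ : ∀ (M : Type u) (_ : AddCommGroup M) (_ : Module ↥T M), IsSimpleModule ↥T M →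
      ∀ (D : Type u) (_ : AddCommGroup D) (_ : Module A D) (ι : M →+ D),
        IsProperStandardFor K A 𝒜 T Ap M D ι → IsSimpleModule A D)
    (hN : ∀ (M : Type u) (_ : AddCommGroup M) (_ : Module ↥T M), IsSimpleModule ↥T M →
      ∀ (D : Type u) (_ : AddCommGroup D) (_ : Module A D) (p : D →+ M),
        IsProperCostandardFor K A 𝒜 Am T M D p → IsSimpleModule A D) :
    IsSemisimpleRing A := by
  have : IsArtinianRing A := IsArtinianRing.of_finite K A
  have : IsNoetherianRing A := IsNoetherianRing.of_finite K A
  rw [IsArtinianRing.isSemisimpleRing_iff_jacobson]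
  -- maps from left ideals to simple modules extend to `A`
  have hinj : ∀ (S : Type u) [AddCommGroup S] [Module A S] [IsSimpleModule A S]
      (I : Submodule A A) (f : I →ₗ[A] S), ∃ F : A →ₗ[A] S, ∀ x : I, F x = f x := by
    intro S _ _ _ I
    obtain ⟨N, _, _, p, hS⟩ := exists_isProperCostandardFor h hN S
    induction I using WellFoundedGT.induction with
    | ind I ih =>
      intro f
      by_cases hI : I = ⊤
      · subst hI
        exact ⟨f.comp (Submodule.topEquiv (R := A) (M := A)).symm.toLinearMap, fun x => rfl⟩
      obtain ⟨I', hI'⟩ := exists_covBy_of_wellFoundedLT (a := I) (by simpa using hI)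
      have hsimple := (covBy_iff_quot_is_simple hI'.le).1 hI'
      obtain ⟨M, _, _, ι, hD⟩ := exists_isProperStandardFor h hΔ
        (I' ⧸ Submodule.comap I'.subtype I)
      obtain ⟨f', hf'⟩ := exists_extension h hD hS
        (i := Submodule.inclusion hI'.le) (π := Submodule.mkQ _)
        (Submodule.inclusion_injective _) (Submodule.mkQ_surjective _)
        (by
          rw [LinearMap.exact_iff, Submodule.ker_mkQ, Submodule.range_inclusion]) f
      obtain ⟨F, hF⟩ := ih I' hI'.lt f'
      exact ⟨F, fun x => (hF (Submodule.inclusion hI'.le x)).trans (LinearMap.congr_fun hf' x)⟩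
  refine eq_bot_iff.2 fun x hx => ?_
  by_contra hx0
  have hx0 : x ≠ 0 := hx0
  have hne : Submodule.span A {x} ≠ ⊥ := by simpa using hx0
  obtain ⟨S, hS, hle⟩ := (eq_bot_or_exists_atom_le (Submodule.span A {x})).resolve_left hne
  have hSs : IsSimpleModule A S := isSimpleModule_iff_isAtom.2 hS
  obtain ⟨F, hF⟩ := hinj S S LinearMap.id
  have hsurj : Function.Surjective F := fun s => ⟨s, hF s⟩
  have hmax : IsCoatom (LinearMap.ker F) := by
    rw [← isSimpleModule_iff_isCoatom]
    exact (F.quotKerEquivOfSurjective hsurj).isSimpleModule_iff.2 hSs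
  have hxF : x ∈ LinearMap.ker F := (sInf_le hmax : Ring.jacobson A ≤ _) hx
  have hSF : S ≤ LinearMap.ker F := hle.trans ((Submodule.span_singleton_le_iff_mem _ _).2 hxF)
  refine hS.1 (eq_bot_iff.2 fun y hy => ?_)
  have := (hF ⟨y, hy⟩).symm.trans (hSF hy)
  exact congrArg Subtype.val this

end Simple

section Semisimple

variable {K A : Type u} [Field K] [Ring A] [Algebra K A]
  {𝒜 : ℤ → Submodule K A} {Am T Ap : Subalgebra K A}

theorem isSemisimpleRing_T (h : TriangularDecomposition K A 𝒜 Am T Ap) [IsSemisimpleRing A] :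
    IsSemisimpleRing ↥T := by
  obtain ⟨Θ, P, -, -, hΘl, hΘr, -, hΘ1, hPT, hPt, hPl, hPr⟩ := h.exists_projections
  refine (isSemisimpleModule_iff _ _).2 ⟨fun L => ?_⟩
  obtain ⟨C, hC⟩ := exists_isCompl (Submodule.span A ((↑) '' (L : Set ↥T) : Set A))
  obtain ⟨e, he, f, hf, hef⟩ : ∃ e ∈ Submodule.span A ((↑) '' (L : Set ↥T) : Set A),
      ∃ f ∈ C, e + f = 1 := Submodule.mem_sup.1 (hC.sup_eq_top ▸ Submodule.mem_top)
  have hθr : ∀ t ∈ T, ∀ a, P (Θ (a * t)) = P (Θ a) * t := fun t ht a => by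
    rw [hΘr t ht, hPr t ht]
  have hθl : ∀ t ∈ T, ∀ a, P (Θ (t * a)) = t * P (Θ a) := fun t ht a => by
    rw [hΘl t (TriangularDecomposition.T_le_Bneg ht), hPl t ht]
  have hθ : ∀ t ∈ T, P (Θ t) = t := fun t ht => by
    rw [← one_mul t, hθr t ht, hΘ1, hPt 1 T.one_mem]
  have hθL : ∀ x ∈ Submodule.span A ((↑) '' (L : Set ↥T) : Set A),
      (⟨P (Θ x), hPT x⟩ : ↥T) ∈ L := by
    intro x hx
    refine Submodule.closure_induction (p := fun x _ => (⟨P (Θ x), hPT x⟩ : ↥T) ∈ L) ?_ ?_ ?_ hx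
    · simp only [map_zero]
      exact L.zero_mem
    · intro x y _ _ hx hy
      simp only [map_add]
      exact L.add_mem hx hy
    · rintro a _ ⟨t, ht, rfl⟩
      simp only [smul_eq_mul, hθr t t.2]
      exact L.smul_mem ⟨P (Θ a), hPT a⟩ ht
  have hle : ∀ l ∈ L, (l : A) * e = l := by
    intro l hl
    have hlS := Submodule.subset_span (R := A)
      (Set.mem_image_of_mem ((↑) : ↥T → A) (SetLike.mem_coe.2 hl))
    have hsum : (l : A) * e + l * f = l := by rw [← mul_add, hef, mul_one]
    have hlf : (l : A) * f ∈ Submodule.span A ((↑) '' (L : Set ↥T) : Set A) := by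
      rw [← eq_sub_iff_add_eq'] at hsum
      rw [hsum]
      exact sub_mem hlS (Submodule.smul_mem _ _ he)
    have : (l : A) * f = 0 := Submodule.disjoint_def.1 hC.disjoint _ hlf (C.smul_mem _ hf)
    rw [this, add_zero] at hsum
    exact hsum
  set ε : ↥T := ⟨P (Θ e), hPT e⟩ with hε
  have hLε : ∀ l ∈ L, l * ε = l := fun l hl => Subtype.ext <| by
    change (l : A) * P (Θ e) = l
    rw [← hθl l l.2, hle l hl, hθ l l.2]
  let q : ↥T →ₗ[↥T] L :=
    (LinearMap.toSpanSingleton ↥T ↥T ε).codRestrict L fun t => L.smul_mem t (hθL e he)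
  exact ⟨LinearMap.ker q, LinearMap.isCompl_of_proj fun l => Subtype.ext (hLε l l.2)⟩

theorem IsProperStandardFor.nontrivial (h : TriangularDecomposition K A 𝒜 Am T Ap)
    {M D : Type u} [AddCommGroup M] [Module ↥T M] [Nontrivial M] [AddCommGroup D] [Module A D]
    {ι : M →+ D} (hD : IsProperStandardFor K A 𝒜 T Ap M D ι) : Nontrivial D := by
  obtain ⟨Θ, P, -, -, -, hΘr, hΘ0, hΘ1, hPT, hPt, -, hPr⟩ := h.exists_projections
  let θ : A →+ ↥T := AddMonoidHom.mk' (fun a => ⟨P (Θ a), hPT a⟩) fun a b => Subtype.ext (by simp)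
  have hθr : ∀ (t : ↥T) a, θ (a * t) = θ a * t := fun t a => Subtype.ext <| by
    change P (Θ _) = P (Θ a) * t
    rw [hΘr t t.2, hPr t t.2]
  have hθ1 : θ 1 = 1 := Subtype.ext <| by
    change P (Θ 1) = 1
    rw [hΘ1, hPt 1 T.one_mem]
  have hθ0 : ∀ j ∈ Jpos K A 𝒜 T Ap, ∀ a, θ (a * j) = 0 := fun j hj a => Subtype.ext <| by
    change P (Θ _) = 0
    rw [hΘ0 j hj, map_zero]
  obtain ⟨s, hs⟩ := hD.exists_balanced_lift ((smulAddHom ↥T M).comp θ).flip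
    (fun t a m => by simp [hθr, mul_smul]) (fun j hj a m => by simp [hθ0 j hj])
  obtain ⟨m, hm⟩ := exists_ne (0 : M)
  refine ⟨ι m, 0, fun h0 => hm ?_⟩
  have := hs 1 m
  simpa [h0, hθ1] using this.symm

theorem IsProperStandardFor.exists_sub_mem_smulJneg (h : TriangularDecomposition K A 𝒜 Am T Ap)
    {M D : Type u} [AddCommGroup M] [Module ↥T M] [AddCommGroup D] [Module A D]
    {ι : M →+ D} (hD : IsProperStandardFor K A 𝒜 T Ap M D ι) (x : D) :
    ∃ m, x - ι m ∈ smulJneg h D := by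
  obtain ⟨Θ, -, hΘB, hΘJ, -⟩ := h.exists_projections
  refine hD.induction (P := fun x => ∃ m, x - ι m ∈ smulJneg h D) ⟨0, by simp⟩ ?_ ?_ x
  · rintro x y ⟨m, hm⟩ ⟨m', hm'⟩
    exact ⟨m + m', by rw [map_add, add_sub_add_comm]; exact add_mem hm hm'⟩
  · intro a m
    have hc := smul_eq_zero_of_annihilated (hD.2.1 · · m) (hΘJ a)
    rw [sub_smul, sub_eq_zero] at hc
    obtain ⟨t, ht, j, hj, htj⟩ := Submodule.mem_sup.1 (h.Bneg_le_sup (hΘB a))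
    refine ⟨(⟨t, ht⟩ : ↥T) • m, ?_⟩
    rw [hc, ← htj, add_smul, hD.1, add_sub_cancel_left]
    exact smul_mem_smulSubgroup hj _

theorem IsProperStandardFor.isSimpleModule [FiniteDimensional K A]
    (h : TriangularDecomposition K A 𝒜 Am T Ap) [IsSemisimpleRing A]
    {M D : Type u} [AddCommGroup M] [Module ↥T M] [IsSimpleModule ↥T M] [AddCommGroup D]
    [Module A D] {ι : M →+ D} (hD : IsProperStandardFor K A 𝒜 T Ap M D ι) :
    IsSimpleModule A D := by
  have := IsSimpleModule.nontrivial (↥T) M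
  have := hD.nontrivial h
  obtain ⟨n, hn⟩ := h.Jneg_nilpotent
  let ιT : M →ₗ[↥T] D := { ι with map_smul' := hD.1 }
  have hgen := hD.exists_sub_mem_smulJneg h
  have hproper : ∀ X : Submodule A D, X ≠ ⊤ → ∀ x ∈ X, x ∈ smulJneg h D := by
    intro X hX x hx
    let XT : Submodule ↥T D :=
      { X.toAddSubgroup with smul_mem' := fun t x hx => X.smul_mem (t : A) hx }
    rcases eq_bot_or_eq_top ((XT ⊔ smulJneg h D).comap ιT) with hbot | htop
    · obtain ⟨m, hm⟩ := hgen x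
      have hmem : m ∈ (XT ⊔ smulJneg h D).comap ιT := by
        have : ι m = x - (x - ι m) := (sub_sub_cancel _ _).symm
        rw [Submodule.mem_comap]
        change ι m ∈ _
        rw [this]
        exact sub_mem (Submodule.mem_sup_left hx) (Submodule.mem_sup_right hm)
      rw [hbot, Submodule.mem_bot] at hmem
      simpa [hmem] using hm
    · refine absurd (eq_top_of_sup_smulSubgroup (Y := X) hn (eq_top_iff.2 fun y _ => ?_)) hX
      obtain ⟨m, hm⟩ := hgen y
      have hmem : ι m ∈ XT ⊔ smulJneg h D :=
        (htop ▸ Submodule.mem_top : m ∈ (XT ⊔ smulJneg h D).comap ιT)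
      obtain ⟨u, hu, v, hv, huv⟩ := Submodule.mem_sup.1 hmem
      refine AddSubgroup.mem_sup.2 ⟨u, hu, v + (y - ι m), add_mem hv hm, ?_⟩
      rw [← huv]
      abel
  rw [isSimpleModule_iff]
  refine ⟨fun X => ?_⟩
  obtain ⟨Y, hXY⟩ := exists_isCompl X
  by_cases hX : X = ⊤
  · exact Or.inr hX
  by_cases hY : Y = ⊤
  · exact Or.inl (by simpa [hY] using hXY.inf_eq_bot)
  refine absurd (eq_top_iff.2 fun x _ => ?_) (smulSubgroup_ne_top (X := D) hn)
  have hx : x ∈ X ⊔ Y := hXY.sup_eq_top ▸ Submodule.mem_top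
  obtain ⟨y, hy, z, hz, rfl⟩ := Submodule.mem_sup.1 hx
  exact add_mem (hproper X hX y hy) (hproper Y hY z hz)

theorem IsProperCostandardFor.nontrivial [FiniteDimensional K A]
    (h : TriangularDecomposition K A 𝒜 Am T Ap)
    {M D : Type u} [AddCommGroup M] [Module ↥T M] [IsSimpleModule ↥T M] [AddCommGroup D]
    [Module A D] {p : D →+ M} (hD : IsProperCostandardFor K A 𝒜 Am T M D p) : Nontrivial D := by
  have := IsSimpleModule.nontrivial (↥T) M
  obtain ⟨D₀, _, _, ι, h₀⟩ := exists_properStandard 𝒜 T Ap M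
  have := h₀.nontrivial h
  have := Submodule.Quotient.nontrivial_iff.2 (smulJneg_ne_top h D₀)
  let ιT : M →ₗ[↥T] D₀ := { ι with map_smul' := h₀.1 }
  let g : M →ₗ[↥T] D₀ ⧸ smulJneg h D₀ := (smulJneg h D₀).mkQ.comp ιT
  have hsurj : Function.Surjective g := by
    intro y
    obtain ⟨x, rfl⟩ := (smulJneg h D₀).mkQ_surjective y
    obtain ⟨m, hm⟩ := h₀.exists_sub_mem_smulJneg h x
    exact ⟨m, ((Submodule.Quotient.eq _).2 hm).symm⟩
  have hg0 : g ≠ 0 := by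
    intro h0
    obtain ⟨y, hy⟩ := exists_ne (0 : D₀ ⧸ smulJneg h D₀)
    obtain ⟨m, rfl⟩ := hsurj y
    exact hy (LinearMap.congr_fun h0 m)
  let e := LinearEquiv.ofBijective g ⟨LinearMap.injective_of_ne_zero hg0, hsurj⟩
  let f : D₀ →ₗ[↥T] M := e.symm.toLinearMap.comp (smulJneg h D₀).mkQ
  obtain ⟨F, hF, -⟩ := hD.2.2 D₀ f.toAddMonoidHom (fun t x => map_smul f t x) (fun a ha x => by
    have : (smulJneg h D₀).mkQ (a • x) = 0 :=
      (Submodule.Quotient.mk_eq_zero _).2 (smul_mem_smulSubgroup ha x)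
    change e.symm ((smulJneg h D₀).mkQ (a • x)) = 0
    rw [this, map_zero])
  obtain ⟨m, hm⟩ := exists_ne (0 : M)
  refine ⟨F (ι m), 0, fun h0 => hm ?_⟩
  have := hF (ι m)
  rw [h0, map_zero] at this
  exact (e.symm_apply_apply m).symm.trans this.symm

theorem IsProperCostandardFor.eq_zero_of_mem_invariants
    (h : TriangularDecomposition K A 𝒜 Am T Ap)
    {M D : Type u} [AddCommGroup M] [Module ↥T M] [AddCommGroup D] [Module A D] {p : D →+ M}
    (hD : IsProperCostandardFor K A 𝒜 Am T M D p) {x : D} (hx : x ∈ invariants h D)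
    (hpx : p x = 0) : x = 0 := by
  obtain ⟨Θ, -, hΘB, hΘJ, -⟩ := h.exists_projections
  have : LinearMap.toSpanSingleton A D x = 0 := hD.hom_ext fun a => by
    have hc := smul_eq_zero_of_annihilated hx (hΘJ a)
    rw [sub_smul, sub_eq_zero] at hc
    obtain ⟨t, ht, j, hj, htj⟩ := Submodule.mem_sup.1 (h.Bneg_le_sup (hΘB a))
    rw [LinearMap.toSpanSingleton_apply, hc, ← htj, add_smul, map_add, hD.2.1 j hj,
      hD.1 ⟨t, ht⟩, hpx, smul_zero, LinearMap.zero_apply, map_zero, add_zero]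
  simpa using LinearMap.congr_fun this 1

theorem IsProperCostandardFor.isSimpleModule [FiniteDimensional K A]
    (h : TriangularDecomposition K A 𝒜 Am T Ap) [IsSemisimpleRing A]
    {M D : Type u} [AddCommGroup M] [Module ↥T M] [IsSimpleModule ↥T M] [AddCommGroup D]
    [Module A D] {p : D →+ M} (hD : IsProperCostandardFor K A 𝒜 Am T M D p) :
    IsSimpleModule A D := by
  have := hD.nontrivial h
  obtain ⟨n, hn⟩ := h.Jpos_nilpotent
  have hinv : ∀ X : Submodule A D, X ≠ ⊥ → ∃ x ∈ X, x ∈ invariants h D ∧ x ≠ 0 := by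
    intro X hX
    have := (Submodule.nontrivial_iff_ne_bot).2 hX
    obtain ⟨x, hx0, hx⟩ := exists_ne_zero_annihilated (X := X) hn
    exact ⟨x, x.2, fun j hj => congrArg Subtype.val (hx j hj), by simpa using hx0⟩
  rw [isSimpleModule_iff]
  refine ⟨fun X => ?_⟩
  obtain ⟨Y, hXY⟩ := exists_isCompl X
  by_cases hX : X = ⊥
  · exact Or.inl hX
  by_cases hY : Y = ⊥
  · exact Or.inr (by simpa [hY] using hXY.sup_eq_top)
  obtain ⟨x, hxX, hx, hx0⟩ := hinv X hX
  obtain ⟨y, hyY, hy, hy0⟩ := hinv Y hY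
  have hpx : p x ≠ 0 := fun h0 => hx0 (hD.eq_zero_of_mem_invariants h hx h0)
  obtain ⟨t, ht⟩ := IsSimpleModule.toSpanSingleton_surjective (↥T) hpx (p y)
  have hxy : t • x - y = 0 := hD.eq_zero_of_mem_invariants h
    (sub_mem (Submodule.smul_mem _ t hx) hy) <| by
      rw [map_sub, Subalgebra.smul_def, hD.1, ← ht, LinearMap.toSpanSingleton_apply, sub_self]
  have hyX : y ∈ X := sub_eq_zero.1 hxy ▸ X.smul_mem (t : A) hxX
  exact absurd (Submodule.disjoint_def.1 hXY.disjoint y hyX hyY) hy0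

end Semisimple

/-- `A` is semisimple if and only if `T` is semisimple and both the
proper standard module `Δ̄(λ)` and the proper costandard module `∇̄(λ)` are simple for
every simple `T`-module `λ`. -/
theorem semisimple_iff (K A : Type u) [Field K] [Ring A] [Algebra K A]
    [FiniteDimensional K A] (𝒜 : ℤ → Submodule K A) (Am T Ap : Subalgebra K A)
    (h : TriangularDecomposition K A 𝒜 Am T Ap) :
    IsSemisimpleRing A ↔
      (IsSemisimpleRing ↥T ∧
       (∀ (M : Type u) (_ : AddCommGroup M) (_ : Module ↥T M),
          IsSimpleModule ↥T M →
          ∀ (D : Type u) (_ : AddCommGroup D) (_ : Module A D) (ι : M →+ D),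
            IsProperStandardFor K A 𝒜 T Ap M D ι → IsSimpleModule A D) ∧
       (∀ (M : Type u) (_ : AddCommGroup M) (_ : Module ↥T M),
          IsSimpleModule ↥T M →
          ∀ (D : Type u) (_ : AddCommGroup D) (_ : Module A D) (p : D →+ M),
            IsProperCostandardFor K A 𝒜 Am T M D p → IsSimpleModule A D)) := by
  constructor
  · intro _
    exact ⟨isSemisimpleRing_T h,
      fun M _ _ _ D _ _ ι hD => hD.isSimpleModule h,
      fun M _ _ _ D _ _ p hD => hD.isSimpleModule h⟩
  · rintro ⟨_, hΔ, hN⟩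
    exact isSemisimpleRing_of_simple h hΔ hN

end TriangularPaper
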